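/- arXiv:2409.08106 — 5 statements merged into one kernel-verified Lean document; each statement's English description precedes it below -/
import Mathlib

section
/- Let H = (V, E) be a finite weighted hypergraph with all-or-nothing splitting functions and let G be the weighted directed graph obtained from H by the adapted CB-gadget construction. For every T ∈ 𝒯 with vol_G(T) ≤ vol_G(V̂\T), setting S = T ∩ V, we have 2·φ_G(T) ≥ μ_H(S). -/
open Finset

variable {V ι : Type*} [Fintype V] [DecidableEq V] [Fintype ι] [DecidableEq ι]

/-- The all-or-nothing cut value of a vertex subset `S` in a weighted hypergraph whose
hyperedges are `inc e` with weights `w e`: the total weight of hyperedges split by `S`. -/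
noncomputable def cutH (inc : ι → Finset V) (w : ι → ℝ) (S : Finset V) : ℝ :=
  ∑ e ∈ univ.filter (fun e => ((inc e) ∩ S).Nonempty ∧ ((inc e) \ S).Nonempty), w e

/-- Weighted degree of a vertex: total weight of hyperedges containing it. -/
noncomputable def degH (inc : ι → Finset V) (w : ι → ℝ) (i : V) : ℝ :=
  ∑ e ∈ univ.filter (fun e => i ∈ inc e), w e

/-- Volume of a vertex subset: sum of degrees of its vertices. -/
noncomputable def volH (inc : ι → Finset V) (w : ι → ℝ) (S : Finset V) : ℝ :=
  ∑ i ∈ S, degH inc w i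

/-- `ε`: the maximum cardinality of a hyperedge. -/
def epsH (inc : ι → Finset V) : ℕ := univ.sup fun e => (inc e).card

/-- `ν`: the maximum number of hyperedges containing a single vertex. -/
def nuH (inc : ι → Finset V) : ℕ :=
  univ.sup fun v : V => (univ.filter (fun e => v ∈ inc e)).card

/-- `β = (ε + 1) · ν`. -/
noncomputable def betaH (inc : ι → Finset V) : ℝ := ((epsH inc : ℝ) + 1) * (nuH inc : ℝ)

/-- `μ_H(S) = 2 cut_H(S) / (vol_H(S) + β |S|)`. -/
noncomputable def muH (inc : ι → Finset V) (w : ι → ℝ) (S : Finset V) : ℝ :=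
  2 * cutH inc w S / (volH inc w S + betaH inc * (S.card : ℝ))

/-- Edge weights of the weighted directed graph produced by the adapted CB-gadget
construction. The vertex set is `V̂ = V ⊕ ι ⊕ ι`, where `Sum.inl v` is an original vertex,
`Sum.inr (Sum.inl e)` is the auxiliary node `a_e`, and `Sum.inr (Sum.inr e)` is the auxiliary
node `b_e`. For each `v ∈ inc e` there are edges `(v, a_e)` and `(b_e, v)` of weight `1`,
a self-loop `(a_e, a_e)` of weight `1 - w e`, and an edge `(a_e, b_e)` of weight `w e`.
All other weights are `0`. -/
noncomputable def wG (inc : ι → Finset V) (w : ι → ℝ) :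
    (V ⊕ ι ⊕ ι) → (V ⊕ ι ⊕ ι) → ℝ
  | Sum.inl v, Sum.inr (Sum.inl e) => if v ∈ inc e then 1 else 0
  | Sum.inr (Sum.inr e), Sum.inl v => if v ∈ inc e then 1 else 0
  | Sum.inr (Sum.inl e), Sum.inr (Sum.inl e') => if e = e' then 1 - w e else 0
  | Sum.inr (Sum.inl e), Sum.inr (Sum.inr e') => if e = e' then w e else 0
  | _, _ => 0

/-- Directed cut value in the gadget graph: total weight of edges from `T` to its complement. -/
noncomputable def cutG (inc : ι → Finset V) (w : ι → ℝ) (T : Finset (V ⊕ ι ⊕ ι)) : ℝ :=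
  ∑ x ∈ T, ∑ y ∈ Tᶜ, wG inc w x y

/-- Out-degree (total outgoing weight, including self-loops) of a node in the gadget graph. -/
noncomputable def outdegG (inc : ι → Finset V) (w : ι → ℝ) (x : V ⊕ ι ⊕ ι) : ℝ :=
  ∑ y, wG inc w x y

/-- Out-volume of a node subset in the gadget graph. -/
noncomputable def volG (inc : ι → Finset V) (w : ι → ℝ) (T : Finset (V ⊕ ι ⊕ ι)) : ℝ :=
  ∑ x ∈ T, outdegG inc w x

/-- Conductance of a node subset in the gadget graph. -/
noncomputable def phiG (inc : ι → Finset V) (w : ι → ℝ) (T : Finset (V ⊕ ι ⊕ ι)) : ℝ :=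
  cutG inc w T / min (volG inc w T) (volG inc w Tᶜ)

/-- Membership in the family `𝒯`: every auxiliary node of `T` has an in- or out-neighbor
among the original vertices of `T`. -/
def memT (inc : ι → Finset V) (w : ι → ℝ) (T : Finset (V ⊕ ι ⊕ ι)) : Prop :=
  ∀ c : ι ⊕ ι, Sum.inr c ∈ T → ∃ v : V, Sum.inl v ∈ T ∧
    (wG inc w (Sum.inr c) (Sum.inl v) ≠ 0 ∨ wG inc w (Sum.inl v) (Sum.inr c) ≠ 0)

theorem cutG_eq_sum_hyperedges (inc : ι → Finset V) (w : ι → ℝ) (T : Finset (V ⊕ ι ⊕ ι))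
    (S : Finset V) (hS : ∀ v : V, v ∈ S ↔ Sum.inl v ∈ T) :
    cutG inc w T = ∑ e, ((if Sum.inr (Sum.inl e) ∈ T then 0 else ((inc e ∩ S).card : ℝ)) +
      (if Sum.inr (Sum.inl e) ∈ T ∧ Sum.inr (Sum.inr e) ∉ T then w e else 0) +
      (if Sum.inr (Sum.inr e) ∈ T then ((inc e \ S).card : ℝ) else 0)) := by
  have expand : cutG inc w T =
      ∑ x, ∑ y, if x ∈ T ∧ y ∉ T then wG inc w x y else 0 := by
    rw [cutG, ← sum_ite_mem_eq T]
    refine sum_congr rfl fun x _ => ?_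
    rw [← sum_ite_mem_eq Tᶜ]
    by_cases hx : x ∈ T <;> simp [hx]
  rw [expand]
  simp only [Fintype.sum_sum_type, wG, ite_self, sum_const_zero, add_zero, zero_add,
    sum_add_distrib]
  rw [add_comm]
  refine congrArg₂ _ ((add_assoc _ _ _).trans <|
    congrArg₂ _ (sum_comm.trans (sum_congr rfl fun e _ => ?_)) ?_) ?_
  · by_cases ha : Sum.inr (Sum.inl e) ∈ T
    · simp [ha]
    · simp only [ha, ← hS, not_false_eq_true, and_true, if_false, ← ite_and]
      rw [← sum_filter, sum_const, nsmul_one]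
      congr 2
      ext v
      simp [and_comm]
  · rw [← sum_add_distrib]
    refine sum_congr rfl fun e _ => ?_
    rw [sum_eq_single e, sum_eq_single e] <;> grind
  · refine sum_congr rfl fun e _ => ?_
    by_cases hb : Sum.inr (Sum.inr e) ∈ T
    · simp only [hb, ← hS, true_and, if_true, ← ite_and]
      rw [← sum_filter, sum_const, nsmul_one]
      congr 2
      ext v
      simp [and_comm]
    · simp [hb]

theorem volG_eq_sum_hyperedges (inc : ι → Finset V) (w : ι → ℝ) (T : Finset (V ⊕ ι ⊕ ι))
    (S : Finset V) (hS : ∀ v : V, v ∈ S ↔ Sum.inl v ∈ T) :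
    volG inc w T = ∑ e, (((inc e ∩ S).card : ℝ) +
      (if Sum.inr (Sum.inl e) ∈ T then 1 else 0) +
      (if Sum.inr (Sum.inr e) ∈ T then ((inc e).card : ℝ) else 0)) := by
  have expand : volG inc w T = ∑ x, if x ∈ T then ∑ y, wG inc w x y else 0 := by
    rw [sum_ite_mem_eq]
    rfl
  rw [expand]
  simp only [Fintype.sum_sum_type, wG, sum_const_zero, add_zero, zero_add, sum_add_distrib, ← hS]
  rw [sum_ite_mem_eq, ← add_assoc]
  refine congrArg₂ _ (congrArg₂ _ (sum_comm.trans (sum_congr rfl fun e _ => ?_)) ?_) ?_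
  · simp [inter_comm]
  · simp
  · simp

theorem volH_eq_sum_hyperedges (inc : ι → Finset V) (w : ι → ℝ) (S : Finset V) :
    volH inc w S = ∑ e, w e * ((inc e ∩ S).card : ℝ) := by
  simp only [volH, degH, sum_filter]
  rw [sum_comm]
  refine sum_congr rfl fun e _ => ?_
  simp [inter_comm, mul_comm]

theorem sum_card_inter_le_nuH_mul_card (inc : ι → Finset V) (S : Finset V) :
    ∑ e, ((inc e ∩ S).card : ℝ) ≤ (nuH inc : ℝ) * (S.card : ℝ) := by
  have double_count : ∑ e, (inc e ∩ S).card = ∑ v ∈ S, #{e | v ∈ inc e} := by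
    simp only [card_filter]
    rw [sum_comm]
    refine sum_congr rfl fun e _ => ?_
    simp [inter_comm]
  have bound : ∑ v ∈ S, #{e | v ∈ inc e} ≤ S.card * nuH inc := by
    rw [← smul_eq_mul]
    exact sum_le_card_nsmul _ _ _ fun v _ =>
      le_sup (f := fun v : V => #{e | v ∈ inc e}) (mem_univ v)
  rw [mul_comm]
  exact_mod_cast double_count ▸ bound

theorem card_inter_pos_of_memT {inc : ι → Finset V} {w : ι → ℝ} {T : Finset (V ⊕ ι ⊕ ι)}
    (hT : memT inc w T) {S : Finset V} (hS : ∀ v : V, v ∈ S ↔ Sum.inl v ∈ T) {e : ι}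
    (he : Sum.inr (Sum.inl e) ∈ T ∨ Sum.inr (Sum.inr e) ∈ T) : 0 < (inc e ∩ S).card := by
  rw [card_pos]
  rcases he with he | he <;> obtain ⟨v, hv, hne⟩ := hT _ he <;>
    exact ⟨v, mem_inter.2 ⟨by simpa [wG] using hne, (hS v).2 hv⟩⟩

/-- The weight deficit `∑ (1 - w e)` over the hyperedges split by `S` with `b_e ∈ T`. -/
noncomputable def splitDeficit (inc : ι → Finset V) (w : ι → ℝ) (T : Finset (V ⊕ ι ⊕ ι))
    (S : Finset V) : ℝ :=
  ∑ e, if ((inc e ∩ S).Nonempty ∧ (inc e \ S).Nonempty) ∧ Sum.inr (Sum.inr e) ∈ T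
    then 1 - w e else 0

theorem splitDeficit_nonneg (inc : ι → Finset V) {w : ι → ℝ} (hwle : ∀ e, w e ≤ 1)
    (T : Finset (V ⊕ ι ⊕ ι)) (S : Finset V) : 0 ≤ splitDeficit inc w T S :=
  sum_nonneg fun e _ => by have := hwle e; split_ifs <;> linarith

theorem cutH_add_splitDeficit_le_cutG (inc : ι → Finset V) {w : ι → ℝ}
    (hwpos : ∀ e, 0 < w e) (hwle : ∀ e, w e ≤ 1) {T : Finset (V ⊕ ι ⊕ ι)}
    {S : Finset V} (hS : ∀ v : V, v ∈ S ↔ Sum.inl v ∈ T) :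
    cutH inc w S + splitDeficit inc w T S ≤ cutG inc w T := by
  rw [cutG_eq_sum_hyperedges inc w T S hS, cutH, sum_filter, splitDeficit, ← sum_add_distrib]
  refine sum_le_sum fun e _ => ?_
  have hpos := hwpos e
  have hle := hwle e
  have hk : (0 : ℝ) ≤ (inc e ∩ S).card := Nat.cast_nonneg _
  have hc : (0 : ℝ) ≤ (inc e \ S).card := Nat.cast_nonneg _
  by_cases hsplit : (inc e ∩ S).Nonempty ∧ (inc e \ S).Nonempty
  · have hk1 : (1 : ℝ) ≤ (inc e ∩ S).card := by exact_mod_cast hsplit.1.card_pos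
    have hc1 : (1 : ℝ) ≤ (inc e \ S).card := by exact_mod_cast hsplit.2.card_pos
    by_cases ha : Sum.inr (Sum.inl e) ∈ T <;> by_cases hb : Sum.inr (Sum.inr e) ∈ T <;>
      simp only [hsplit, ha, hb, and_self, not_true_eq_false, not_false_eq_true, if_true,
        if_false, and_true, and_false] <;> linarith
  · simp only [hsplit, false_and, if_false]
    split_ifs <;> linarith

theorem volG_le_add_splitDeficit {inc : ι → Finset V} {w : ι → ℝ}
    (hcard : ∀ e, 2 ≤ (inc e).card) (hwpos : ∀ e, 0 < w e) (hwle : ∀ e, w e ≤ 1)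
    {T : Finset (V ⊕ ι ⊕ ι)} (hT : memT inc w T)
    {S : Finset V} (hS : ∀ v : V, v ∈ S ↔ Sum.inl v ∈ T) :
    volG inc w T ≤ volH inc w S + betaH inc * (S.card : ℝ) + splitDeficit inc w T S := by
  have hbeta : ∑ e, ((epsH inc : ℝ) + 1) * ((inc e ∩ S).card : ℝ) ≤
      betaH inc * (S.card : ℝ) := by
    rw [← mul_sum, betaH, mul_assoc]
    exact mul_le_mul_of_nonneg_left (sum_card_inter_le_nuH_mul_card inc S) (by positivity)
  suffices volG inc w T ≤ volH inc w S +
      ∑ e, ((epsH inc : ℝ) + 1) * ((inc e ∩ S).card : ℝ) + splitDeficit inc w T S by linarith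
  rw [volG_eq_sum_hyperedges inc w T S hS, volH_eq_sum_hyperedges, splitDeficit,
    ← sum_add_distrib, ← sum_add_distrib]
  refine sum_le_sum fun e _ => ?_
  have hpos := hwpos e
  have hle := hwle e
  have hs2 : (2 : ℝ) ≤ (inc e).card := by exact_mod_cast hcard e
  have hseps : ((inc e).card : ℝ) ≤ epsH inc := by
    exact_mod_cast le_sup (f := fun e => (inc e).card) (mem_univ e)
  have hk : (0 : ℝ) ≤ (inc e ∩ S).card := Nat.cast_nonneg _
  have hwk : 0 ≤ w e * ((inc e ∩ S).card : ℝ) := by positivity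
  by_cases haux : Sum.inr (Sum.inl e) ∈ T ∨ Sum.inr (Sum.inr e) ∈ T
  · have hk1 : (1 : ℝ) ≤ (inc e ∩ S).card := by
      exact_mod_cast card_inter_pos_of_memT hT hS haux
    by_cases hsplit : (inc e ∩ S).Nonempty ∧ (inc e \ S).Nonempty
    · simp only [hsplit, true_and, and_self]
      split_ifs <;> nlinarith
    · have hk2 : (2 : ℝ) ≤ (inc e ∩ S).card := by
        have hsub : inc e ⊆ S := by
          rw [← sdiff_eq_empty_iff_subset, ← not_nonempty_iff_eq_empty]
          exact fun h => hsplit ⟨card_pos.1 (card_inter_pos_of_memT hT hS haux), h⟩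
        rwa [inter_eq_left.2 hsub]
      simp only [hsplit, false_and, if_false]
      split_ifs <;> nlinarith
  · obtain ⟨ha, hb⟩ := not_or.1 haux
    simp only [ha, hb, and_false, if_false]
    nlinarith

theorem cutH_nonneg (inc : ι → Finset V) {w : ι → ℝ} (hwpos : ∀ e, 0 < w e) (S : Finset V) :
    0 ≤ cutH inc w S :=
  sum_nonneg fun e _ => (hwpos e).le

theorem cutH_le_volH (inc : ι → Finset V) {w : ι → ℝ} (hwpos : ∀ e, 0 < w e) (S : Finset V) :
    cutH inc w S ≤ volH inc w S := by
  rw [volH_eq_sum_hyperedges, cutH, sum_filter]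
  refine sum_le_sum fun e _ => ?_
  have hpos := hwpos e
  split_ifs with h
  · have : (1 : ℝ) ≤ (inc e ∩ S).card := by exact_mod_cast h.1.card_pos
    nlinarith
  · positivity

theorem cutH_le_volG (inc : ι → Finset V) {w : ι → ℝ} (hwle : ∀ e, w e ≤ 1)
    {T : Finset (V ⊕ ι ⊕ ι)} {S : Finset V} (hS : ∀ v : V, v ∈ S ↔ Sum.inl v ∈ T) :
    cutH inc w S ≤ volG inc w T := by
  rw [volG_eq_sum_hyperedges inc w T S hS, cutH, sum_filter]
  refine sum_le_sum fun e _ => ?_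
  have hle := hwle e
  have hs : (0 : ℝ) ≤ (inc e).card := Nat.cast_nonneg _
  have hk : (0 : ℝ) ≤ (inc e ∩ S).card := Nat.cast_nonneg _
  by_cases hsplit : (inc e ∩ S).Nonempty ∧ (inc e \ S).Nonempty
  · have : (1 : ℝ) ≤ (inc e ∩ S).card := by exact_mod_cast hsplit.1.card_pos
    split_ifs <;> linarith
  · simp only [hsplit, if_false]
    split_ifs <;> linarith

/-- For every `T ∈ 𝒯` with `vol_G(T) ≤ vol_G(V̂ \ T)`, setting `S = T ∩ V`,
we have `2 φ_G(T) ≥ μ_H(S)`. -/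
theorem two_mul_phiG_ge_muH
    (inc : ι → Finset V) (w : ι → ℝ)
    (hcard : ∀ e, 2 ≤ (inc e).card)
    (hwpos : ∀ e, 0 < w e) (hwle : ∀ e, w e ≤ 1)
    (T : Finset (V ⊕ ι ⊕ ι)) (hT : memT inc w T)
    (hvol : volG inc w T ≤ volG inc w Tᶜ)
    (S : Finset V) (hS : ∀ v : V, v ∈ S ↔ Sum.inl v ∈ T) :
    2 * phiG inc w T ≥ muH inc w S := by
  have hcutH := cutH_nonneg inc hwpos S
  have hdef := splitDeficit_nonneg inc hwle T S
  have hcut := cutH_add_splitDeficit_le_cutG inc hwpos hwle hS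
  have hvolG := volG_le_add_splitDeficit hcard hwpos hwle hT hS
  have hcutvol := cutH_le_volG inc hwle hS
  have hbeta : 0 ≤ betaH inc * (S.card : ℝ) := by unfold betaH; positivity
  have hcutD : cutH inc w S ≤ volH inc w S + betaH inc * (S.card : ℝ) := by
    linarith [cutH_le_volH inc hwpos S]
  rw [ge_iff_le, muH, phiG, min_eq_left hvol, mul_div_assoc]
  refine mul_le_mul_of_nonneg_left ?_ zero_le_two
  rcases hcutH.eq_or_lt with hzero | hpos
  · rw [← hzero, zero_div]
    exact div_nonneg (by linarith) (by linarith)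
  · rw [div_le_div_iff₀ (by linarith) (by linarith)]
    nlinarith
end

section
/- Let H = (V, E) be a finite weighted hypergraph and let G be the weighted directed graph obtained from H by the adapted CB-gadget construction. If H is connected (i.e., any two vertices of V are joined by a path alternating between vertices and hyperedges containing them) and every vertex of V lies in at least one hyperedge, then G is strongly connected: for every ordered pair of distinct vertices u, v ∈ V̂ there is a directed path in G from u to v using only edges of positive weight. -/
open Finset

variable {V ι : Type*} [Fintype V] [DecidableEq V] [Fintype ι] [DecidableEq ι]

/-- Two vertices of a common hyperedge are joined in the gadget graph by `u → a_e → b_e → v`. -/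
theorem reflTransGen_wG_of_mem {inc : ι → Finset V} {w : ι → ℝ} {e : ι} (he : 0 < w e)
    {u v : V} (hu : u ∈ inc e) (hv : v ∈ inc e) :
    Relation.ReflTransGen (fun x y : V ⊕ ι ⊕ ι => 0 < wG inc w x y) (Sum.inl u) (Sum.inl v) :=
  ((Relation.ReflTransGen.single (b := Sum.inr (Sum.inl e)) (by simp [wG, hu])).tail
    (c := Sum.inr (Sum.inr e)) (by simpa [wG] using he)).tail (by simp [wG, hv])

/-- From every node of the gadget graph one can reach an original vertex. -/
theorem exists_reflTransGen_wG_inl {inc : ι → Finset V} {w : ι → ℝ}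
    (hne : ∀ e, (inc e).Nonempty) (hwpos : ∀ e, 0 < w e) (x : V ⊕ ι ⊕ ι) :
    ∃ v : V, Relation.ReflTransGen (fun x y : V ⊕ ι ⊕ ι => 0 < wG inc w x y) x (Sum.inl v) := by
  rcases x with v | e | e
  · exact ⟨v, .refl⟩
  · obtain ⟨v, hv⟩ := hne e
    exact ⟨v, (Relation.ReflTransGen.single (b := Sum.inr (Sum.inr e))
      (by simpa [wG] using hwpos e)).tail (by simp [wG, hv])⟩
  · obtain ⟨v, hv⟩ := hne e
    exact ⟨v, .single (by simp [wG, hv])⟩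

/-- Every node of the gadget graph can be reached from an original vertex. -/
theorem exists_inl_reflTransGen_wG {inc : ι → Finset V} {w : ι → ℝ}
    (hne : ∀ e, (inc e).Nonempty) (hwpos : ∀ e, 0 < w e) (x : V ⊕ ι ⊕ ι) :
    ∃ v : V, Relation.ReflTransGen (fun x y : V ⊕ ι ⊕ ι => 0 < wG inc w x y) (Sum.inl v) x := by
  rcases x with v | e | e
  · exact ⟨v, .refl⟩
  · obtain ⟨v, hv⟩ := hne e
    exact ⟨v, .single (by simp [wG, hv])⟩
  · obtain ⟨v, hv⟩ := hne e
    exact ⟨v, (Relation.ReflTransGen.single (b := Sum.inr (Sum.inl e))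
      (by simp [wG, hv])).tail (by simpa [wG] using hwpos e)⟩

/-- If the hypergraph is connected (any two vertices are joined by a
vertex–hyperedge alternating path) and every vertex lies in at least one hyperedge, then the
adapted CB-gadget graph is strongly connected: for every ordered pair of distinct nodes
`u, v ∈ V̂` there is a directed path from `u` to `v` using only edges of positive weight. -/
theorem gadget_strongly_connected
    (inc : ι → Finset V) (w : ι → ℝ)
    (hcard : ∀ e, 2 ≤ (inc e).card)
    (hwpos : ∀ e, 0 < w e) (hwle : ∀ e, w e ≤ 1)
    (hconn : ∀ u v : V,
      Relation.ReflTransGen (fun x y : V => ∃ e : ι, x ∈ inc e ∧ y ∈ inc e) u v)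
    (hcov : ∀ v : V, ∃ e : ι, v ∈ inc e) :
    ∀ u v : V ⊕ ι ⊕ ι, u ≠ v →
      Relation.TransGen (fun x y : V ⊕ ι ⊕ ι => 0 < wG inc w x y) u v := by
  intro x y hxy
  have hne : ∀ e, (inc e).Nonempty := fun e =>
    Finset.card_pos.mp (two_pos.trans_le (hcard e))
  obtain ⟨u, hu⟩ := exists_reflTransGen_wG_inl hne hwpos x
  obtain ⟨v, hv⟩ := exists_inl_reflTransGen_wG hne hwpos y
  have huv : Relation.ReflTransGen (fun x y : V ⊕ ι ⊕ ι => 0 < wG inc w x y)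
      (Sum.inl u) (Sum.inl v) :=
    Relation.ReflTransGen.lift' Sum.inl
      (fun _ _ ⟨e, ha, hb⟩ => reflTransGen_wG_of_mem (hwpos e) ha hb) u v (hconn u v)
  exact (Relation.reflTransGen_iff_eq_or_transGen.mp ((hu.trans huv).trans hv)).resolve_left
    hxy.symm
end

section
/- Let H be a finite n×m real matrix with nonnegative entries, no zero row and no zero column (the vertex–hyperedge incidence matrix of a hypergraph with n vertices and m hyperedges), let D = diag(d_1,…,d_n) with d_i = Σ_j H_{ij} > 0, and let Δ = diag(δ(1),…,δ(m)) with δ(e) = Σ_i H_{ie} > 0. Consider the (n+2m)×(n+2m) block row-stochastic matrix P = [[0, D⁻¹H, 0], [0, 0, I_m], [Δ⁻¹Hᵀ, 0, 0]]. Then the row vector φ = (1/vol(G))·(d_1,…,d_n, δ(1),…,δ(m), δ(1),…,δ(m)), where vol(G) = Σ_i d_i + 2Σ_e δ(e), satisfies φP = φ; i.e., φ is a stationary distribution of P. -/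
open Matrix

variable {n m : ℕ}

/-- Vertex degree `d_i = Σ_e H_{ie}` of a vertex–hyperedge incidence matrix `H`. -/
noncomputable def dDeg (H : Matrix (Fin n) (Fin m) ℝ) (i : Fin n) : ℝ := ∑ e, H i e

/-- Hyperedge size `δ(e) = Σ_i H_{ie}` of a vertex–hyperedge incidence matrix `H`. -/
noncomputable def δDeg (H : Matrix (Fin n) (Fin m) ℝ) (e : Fin m) : ℝ := ∑ i, H i e

/-- `vol(G) = Σ_i d_i + 2 Σ_e δ(e)`. -/
noncomputable def volCB (H : Matrix (Fin n) (Fin m) ℝ) : ℝ :=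
  ∑ i, dDeg H i + 2 * ∑ e, δDeg H e

/-- The `(n + 2m) × (n + 2m)` block transition matrix
`P = [[0, D⁻¹H, 0], [0, 0, I], [Δ⁻¹Hᵀ, 0, 0]]` of the random walk on the adapted CB-gadget
graph with all gadget weights `1` (`W = I`): indices `Sum.inl i` are vertices,
`Sum.inr (Sum.inl e)` are `a`-nodes, and `Sum.inr (Sum.inr e)` are `b`-nodes. -/
noncomputable def Pcb (H : Matrix (Fin n) (Fin m) ℝ) :
    Matrix (Fin n ⊕ Fin m ⊕ Fin m) (Fin n ⊕ Fin m ⊕ Fin m) ℝ :=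
  Matrix.of fun x y =>
    match x, y with
    | Sum.inl i, Sum.inr (Sum.inl e) => H i e / dDeg H i
    | Sum.inr (Sum.inl e), Sum.inr (Sum.inr e') => if e = e' then 1 else 0
    | Sum.inr (Sum.inr e), Sum.inl i => H i e / δDeg H e
    | _, _ => 0

/-- The row vector `φ = (1/vol(G)) · (d_1, …, d_n, δ(1), …, δ(m), δ(1), …, δ(m))`. -/
noncomputable def φcb (H : Matrix (Fin n) (Fin m) ℝ) : (Fin n ⊕ Fin m ⊕ Fin m) → ℝ :=
  Sum.elim (fun i => dDeg H i / volCB H)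
    (Sum.elim (fun e => δDeg H e / volCB H) (fun e => δDeg H e / volCB H))

/-- If `H` is nonnegative with no zero row and no zero column (equivalently,
all `d_i > 0` and all `δ(e) > 0`), then `φ` is a stationary distribution of `P`: `φ P = φ`. -/
theorem φcb_vecMul_Pcb
    (H : Matrix (Fin n) (Fin m) ℝ)
    (hH : ∀ i e, 0 ≤ H i e)
    (hd : ∀ i, 0 < dDeg H i)
    (hδ : ∀ e, 0 < δDeg H e) :
    φcb H ᵥ* Pcb H = φcb H := by
  have cancel (a b v : ℝ) (hb : 0 < b) : b / v * (a / b) = a / v := by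
    field_simp
  ext x
  rcases x with i | e | e
  · simp only [vecMul, dotProduct, Fintype.sum_sum_type, φcb, Pcb, Matrix.of_apply, Sum.elim_inl,
      Sum.elim_inr, mul_zero, Finset.sum_const_zero, zero_add, cancel _ _ _ (hδ _)]
    rw [← Finset.sum_div, dDeg]
  · simp only [vecMul, dotProduct, Fintype.sum_sum_type, φcb, Pcb, Matrix.of_apply, Sum.elim_inl,
      Sum.elim_inr, mul_zero, Finset.sum_const_zero, add_zero, cancel _ _ _ (hd _)]
    rw [← Finset.sum_div, δDeg]
  · simp [vecMul, dotProduct, φcb, Pcb]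
end

section
/- Let A be an n×m real matrix and let 𝓛 be the (n+2m)×(n+2m) symmetric block matrix 𝓛 = [[I_n, −A/2, −A/2], [−Aᵀ/2, I_m, −I_m/2], [−Aᵀ/2, −I_m/2, I_m]]. If λ ∈ ℝ with λ ≠ 3/2 and (x_v, x_a, x_b) ∈ ℝⁿ × ℝᵐ × ℝᵐ is an eigenvector of 𝓛 with eigenvalue λ, then x_a = x_b and the vertex component satisfies A·Aᵀ·x_v = (1−λ)(1−2λ)·x_v. -/
open Matrix

variable {n m : ℕ}

/-- The `(n + 2m) × (n + 2m)` symmetric block matrix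
`𝓛 = [[I, −A/2, −A/2], [−Aᵀ/2, I, −I/2], [−Aᵀ/2, −I/2, I]]`, the normalized Laplacian of the
adapted CB-gadget graph with `W = I`. Indices `Sum.inl i` are vertices, `Sum.inr (Sum.inl e)`
are `a`-nodes, and `Sum.inr (Sum.inr e)` are `b`-nodes. -/
noncomputable def Lcb (A : Matrix (Fin n) (Fin m) ℝ) :
    Matrix (Fin n ⊕ Fin m ⊕ Fin m) (Fin n ⊕ Fin m ⊕ Fin m) ℝ :=
  Matrix.of fun x y =>
    match x, y with
    | Sum.inl i, Sum.inl i' => if i = i' then 1 else 0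
    | Sum.inl i, Sum.inr (Sum.inl e) => -(A i e) / 2
    | Sum.inl i, Sum.inr (Sum.inr e) => -(A i e) / 2
    | Sum.inr (Sum.inl e), Sum.inl i => -(A i e) / 2
    | Sum.inr (Sum.inl e), Sum.inr (Sum.inl e') => if e = e' then 1 else 0
    | Sum.inr (Sum.inl e), Sum.inr (Sum.inr e') => if e = e' then -(1 / 2) else 0
    | Sum.inr (Sum.inr e), Sum.inl i => -(A i e) / 2
    | Sum.inr (Sum.inr e), Sum.inr (Sum.inl e') => if e = e' then -(1 / 2) else 0
    | Sum.inr (Sum.inr e), Sum.inr (Sum.inr e') => if e = e' then 1 else 0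

/-- The block form of the action of `Lcb A` on a vector split as `(x_v, x_a, x_b)`. -/
theorem Lcb_mulVec_elim (A : Matrix (Fin n) (Fin m) ℝ) (xv : Fin n → ℝ) (xa xb : Fin m → ℝ) :
    Lcb A *ᵥ Sum.elim xv (Sum.elim xa xb) =
      Sum.elim (xv - (1 / 2 : ℝ) • (A *ᵥ xa) - (1 / 2 : ℝ) • (A *ᵥ xb))
        (Sum.elim (-(1 / 2 : ℝ) • (Aᵀ *ᵥ xv) + xa - (1 / 2 : ℝ) • xb)
          (-(1 / 2 : ℝ) • (Aᵀ *ᵥ xv) - (1 / 2 : ℝ) • xa + xb)) := by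
  have half (k : ℕ) (f g : Fin k → ℝ) : ∑ j, -f j / 2 * g j = -(1 / 2) * ∑ j, f j * g j := by
    rw [Finset.mul_sum]
    exact Finset.sum_congr rfl fun j _ => by ring
  ext (i | e | e) <;>
    simp [Lcb, mulVec, dotProduct, Fintype.sum_sum_type, half] <;> ring

/-- If `λ ≠ 3/2` and `(x_v, x_a, x_b)` is an eigenvector of `𝓛` with
eigenvalue `λ`, then `x_a = x_b` and `A Aᵀ x_v = (1 − λ)(1 − 2λ) x_v`. -/
theorem Lcb_eigenvector_vertex_component
    (A : Matrix (Fin n) (Fin m) ℝ) (lam : ℝ) (hlam : lam ≠ 3 / 2)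
    (xv : Fin n → ℝ) (xa xb : Fin m → ℝ)
    (hx : Sum.elim xv (Sum.elim xa xb) ≠ 0)
    (heig : Lcb A *ᵥ Sum.elim xv (Sum.elim xa xb) = lam • Sum.elim xv (Sum.elim xa xb)) :
    xa = xb ∧ (A * Aᵀ) *ᵥ xv = ((1 - lam) * (1 - 2 * lam)) • xv := by
  rw [Lcb_mulVec_elim] at heig
  have hv (i : Fin n) := congrFun heig (Sum.inl i)
  have ha (e : Fin m) := congrFun heig (Sum.inr (Sum.inl e))
  have hb (e : Fin m) := congrFun heig (Sum.inr (Sum.inr e))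
  simp only [Sum.elim_inl, Sum.elim_inr, Pi.add_apply, Pi.sub_apply, Pi.smul_apply,
    smul_eq_mul] at hv ha hb
  have hab : xa = xb := by
    ext e
    have h : (3 / 2 - lam) * (xa e - xb e) = 0 := by linear_combination ha e - hb e
    exact sub_eq_zero.mp ((mul_eq_zero.mp h).resolve_left (sub_ne_zero.mpr hlam.symm))
  subst hab
  have hAt : Aᵀ *ᵥ xv = (1 - 2 * lam) • xa := by
    ext e
    simp only [Pi.smul_apply, smul_eq_mul]
    linear_combination -2 * ha e
  have hA : A *ᵥ xa = (1 - lam) • xv := by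
    ext i
    simp only [Pi.smul_apply, smul_eq_mul]
    linear_combination -hv i
  refine ⟨rfl, ?_⟩
  rw [← mulVec_mulVec, hAt, mulVec_smul, hA, smul_smul, mul_comm]
end

section
/- Let H be a finite n×m real matrix with nonnegative entries, no zero row and no zero column, D = diag(d_i) with d_i = Σ_e H_{ie}, Δ = diag(δ(e)) with δ(e) = Σ_i H_{ie}, and let P be the (n+2m)×(n+2m) block matrix P = [[0, D⁻¹H, 0], [0, 0, I_m], [Δ⁻¹Hᵀ, 0, 0]] with stationary row vector φ = (1/vol(G))·(d; δ; δ), vol(G) = Σ_i d_i + 2Σ_e δ(e), and Φ = diag(φ). Then the normalized combinatorial Laplacian Φ^{−1/2}·(Φ − (ΦP + PᵀΦ)/2)·Φ^{−1/2} equals the block matrix [[I_n, −A/2, −A/2], [−Aᵀ/2, I_m, −I_m/2], [−Aᵀ/2, −I_m/2, I_m]], where A = D^{−1/2}·H·Δ^{−1/2}. -/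
open Matrix

variable {n m : ℕ}

theorem volCB_pos_of_vertex (H : Matrix (Fin n) (Fin m) ℝ) (hd : ∀ i, 0 < dDeg H i)
    (hδ : ∀ e, 0 < δDeg H e) (i : Fin n) : 0 < volCB H :=
  add_pos_of_pos_of_nonneg (Finset.sum_pos (fun i _ => hd i) ⟨i, Finset.mem_univ i⟩)
    (mul_nonneg zero_le_two (Finset.sum_nonneg fun e _ => (hδ e).le))

theorem volCB_pos_of_hyperedge (H : Matrix (Fin n) (Fin m) ℝ) (hd : ∀ i, 0 < dDeg H i)
    (hδ : ∀ e, 0 < δDeg H e) (e : Fin m) : 0 < volCB H :=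
  add_pos_of_nonneg_of_pos (Finset.sum_nonneg fun i _ => (hd i).le)
    (mul_pos zero_lt_two (Finset.sum_pos (fun e _ => hδ e) ⟨e, Finset.mem_univ e⟩))

/-- The common volume factor cancels in the symmetric normalization of an entry. -/
theorem inv_sqrt_div_mul_div_mul_inv_sqrt_div {a b v : ℝ} (hv : 0 < v) (ha : 0 ≤ a)
    (hb : 0 ≤ b) (x : ℝ) :
    (√(a / v))⁻¹ * (x / v) * (√(b / v))⁻¹ = x / (√a * √b) := by
  rw [Real.sqrt_div ha, Real.sqrt_div hb, inv_div, inv_div]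
  calc √v / √a * (x / v) * (√v / √b) = (√v * √v / v) * (x / (√a * √b)) := by ring
    _ = x / (√a * √b) := by rw [Real.mul_self_sqrt hv.le, div_self hv.ne', one_mul]

/-- With `Φ = diag(φ)`, the normalized combinatorial Laplacian
`Φ^{−1/2} (Φ − (ΦP + PᵀΦ)/2) Φ^{−1/2}` equals the block matrix
`[[I, −A/2, −A/2], [−Aᵀ/2, I, −I/2], [−Aᵀ/2, −I/2, I]]` with `A = D^{−1/2} H Δ^{−1/2}`. -/
theorem normalized_laplacian_eq_block
    (H : Matrix (Fin n) (Fin m) ℝ)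
    (hH : ∀ i e, 0 ≤ H i e)
    (hd : ∀ i, 0 < dDeg H i)
    (hδ : ∀ e, 0 < δDeg H e) :
    Matrix.diagonal (fun x => (Real.sqrt (φcb H x))⁻¹) *
        (Matrix.diagonal (φcb H) -
          (2⁻¹ : ℝ) •
            (Matrix.diagonal (φcb H) * Pcb H + (Pcb H)ᵀ * Matrix.diagonal (φcb H))) *
        Matrix.diagonal (fun x => (Real.sqrt (φcb H x))⁻¹) =
      Lcb (Matrix.of fun i e => H i e / (Real.sqrt (dDeg H i) * Real.sqrt (δDeg H e))) := by
  have vertex_pos := volCB_pos_of_vertex H hd hδ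
  have edge_pos := volCB_pos_of_hyperedge H hd hδ
  have cross (i : Fin n) (e : Fin m) := inv_sqrt_div_mul_div_mul_inv_sqrt_div
    (edge_pos e) (hd i).le (hδ e).le (-(H i e) / 2)
  have cross_symm (i : Fin n) (e : Fin m) := inv_sqrt_div_mul_div_mul_inv_sqrt_div
    (edge_pos e) (hδ e).le (hd i).le (-(H i e) / 2)
  have vertex_diag (i : Fin n) := inv_sqrt_div_mul_div_mul_inv_sqrt_div
    (vertex_pos i) (hd i).le (hd i).le (dDeg H i)
  have edge_diag (e : Fin m) (c : ℝ) := inv_sqrt_div_mul_div_mul_inv_sqrt_div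
    (edge_pos e) (hδ e).le (hδ e).le (c * δDeg H e)
  simp only [Real.mul_self_sqrt (hd _).le, div_self (hd _).ne'] at vertex_diag
  simp only [Real.mul_self_sqrt (hδ _).le, mul_div_cancel_right₀ _ (hδ _).ne'] at edge_diag
  ext x y
  rw [mul_diagonal, diagonal_mul, Matrix.sub_apply, Matrix.smul_apply, Matrix.add_apply, diagonal_mul, mul_diagonal,
    transpose_apply]
  rcases x with i | e | e <;> rcases y with j | f | f <;>
    simp only [φcb, Pcb, Lcb, of_apply, Sum.elim_inl, Sum.elim_inr, smul_eq_mul]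
  · by_cases h : i = j
    · subst h; simpa using vertex_diag i
    · simp [h]
  · have := (hd i).ne'
    convert cross i f using 1
    · simp
      field_simp
    · ring
  · have := (hδ f).ne'
    convert cross i f using 1
    · simp
      field_simp
    · ring
  · have := (hd j).ne'
    convert cross_symm j e using 1
    · simp
      field_simp
    · ring
  · by_cases h : e = f
    · subst h; simpa using edge_diag e 1
    · simp [h]
  · by_cases h : e = f
    · subst h
      convert edge_diag e (-(1 / 2)) using 1 <;> simp
      ring
    · simp [h]
  · have := (hδ e).ne'
    convert cross_symm j e using 1
    · simp
      field_simp
    · ring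
  · by_cases h : e = f
    · subst h
      convert edge_diag e (-(1 / 2)) using 1 <;> simp
      ring
    · simp [h, Ne.symm h]
  · by_cases h : e = f
    · subst h; simpa using edge_diag e 1
    · simp [h]
end
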